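/- Let β∈(0,2), s∈{0,1} with s≠β, let h>0, let n≥1 be an integer, set a := c−(n+1)h for a real number c (so that the points y_k = a+kh, k=0,…,n, satisfy y_n = c−h), and let g:[a,c−h]→ℝ be twice continuously differentiable. Let Π g denote the continuous piecewise linear interpolant of g with respect to the nodes y_0,…,y_n, i.e. (Π g)(y) = ((y−y_{k−1})/h)g(y_k) + ((y_k−y)/h)g(y_{k−1}) for y∈[y_{k−1},y_k]. Then |∫_a^{c−h} (g(y)−(Π g)(y)) (c−y)^{s−1−β} dy| ≤ (‖g″‖_{L^∞([a,c−h])} h² / (2|s−β|)) · |h^{s−β} − (c−a)^{s−β}|. -/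

import Mathlib

open MeasureTheory

/-- A lower bound `-M` on the second derivative makes `g + M x² / 2` convex. -/
theorem convexOn_add_sq_of_iteratedDerivWithin_ge {g : ℝ → ℝ} {A B M : ℝ} (hAB : A < B)
    (hg : ContDiffOn ℝ 2 g (Set.Icc A B))
    (hM : ∀ x ∈ Set.Icc A B, -M ≤ iteratedDerivWithin 2 g (Set.Icc A B) x) :
    ConvexOn ℝ (Set.Icc A B) (fun x ↦ g x + M / 2 * x ^ 2) := by
  have hu := uniqueDiffOn_Icc hAB
  refine convexOn_of_hasDerivWithinAt2_nonneg (convex_Icc A B)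
    (f' := fun x ↦ iteratedDerivWithin 1 g (Set.Icc A B) x + M * x)
    (f'' := fun x ↦ iteratedDerivWithin 2 g (Set.Icc A B) x + M) ?_ ?_ ?_ ?_
  · exact hg.continuousOn.add (by fun_prop)
  · intro x hx
    have hd := ((hg.differentiableOn (by norm_num)) x
      (interior_subset hx)).hasDerivWithinAt.mono interior_subset
    rw [← iteratedDerivWithin_one] at hd
    refine hd.add ?_
    have := ((hasDerivAt_pow 2 x).const_mul (M / 2)).hasDerivWithinAt (s := interior (Set.Icc A B))
    convert this using 1
    norm_num
    ring
  · intro x hx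
    have hd := ((hg.differentiableOn_iteratedDerivWithin (m := 1) (by norm_num) hu) x
      (interior_subset hx)).hasDerivWithinAt.mono interior_subset
    rw [← iteratedDerivWithin_succ] at hd
    refine hd.add ?_
    simpa using ((hasDerivAt_id x).const_mul M).hasDerivWithinAt (s := interior (Set.Icc A B))
  · intro x hx
    linarith [hM x (interior_subset hx)]

/-- One-sided error bound for the linear interpolant of `g` on `[p, p + h]`. -/
theorem sub_linear_interpolant_le {g : ℝ → ℝ} {A B M p h y : ℝ} (hh : 0 < h) (hM0 : 0 ≤ M)
    (hg : ContDiffOn ℝ 2 g (Set.Icc A B))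
    (hM : ∀ x ∈ Set.Icc A B, -M ≤ iteratedDerivWithin 2 g (Set.Icc A B) x)
    (hp : A ≤ p) (hq : p + h ≤ B) (hy : y ∈ Set.Icc p (p + h)) :
    g y - ((y - p) / h * g (p + h) + (p + h - y) / h * g p) ≤ M * h ^ 2 / 2 := by
  obtain ⟨hy1, hy2⟩ := hy
  have hp' : p ∈ Set.Icc A B := ⟨hp, by linarith⟩
  have hq' : p + h ∈ Set.Icc A B := ⟨by linarith, hq⟩
  have ha : 0 ≤ (p + h - y) / h := div_nonneg (by linarith) hh.le
  have hb : 0 ≤ (y - p) / h := div_nonneg (by linarith) hh.le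
  have hconv := (convexOn_add_sq_of_iteratedDerivWithin_ge (by linarith) hg hM).2 hp' hq' ha hb
    (by field_simp; ring)
  have hcomb : (p + h - y) / h * p + (y - p) / h * (p + h) = y := by field_simp; ring
  have hsq : (p + h - y) / h * p ^ 2 + (y - p) / h * (p + h) ^ 2
      = y ^ 2 + (y - p) * (p + h - y) := by field_simp; ring
  simp only [smul_eq_mul, hcomb] at hconv
  have hprod : (y - p) * (p + h - y) ≤ h ^ 2 := by nlinarith
  have := mul_le_mul_of_nonneg_left hprod (div_nonneg hM0 zero_le_two)
  linear_combination hconv + this + M / 2 * hsq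

/-- Error bound for the linear interpolant of `g` on `[p, p + h]`. -/
theorem abs_sub_linear_interpolant_le {g : ℝ → ℝ} {A B M p h y : ℝ} (hh : 0 < h) (hM0 : 0 ≤ M)
    (hg : ContDiffOn ℝ 2 g (Set.Icc A B))
    (hM : ∀ x ∈ Set.Icc A B, |iteratedDerivWithin 2 g (Set.Icc A B) x| ≤ M)
    (hp : A ≤ p) (hq : p + h ≤ B) (hy : y ∈ Set.Icc p (p + h)) :
    |g y - ((y - p) / h * g (p + h) + (p + h - y) / h * g p)| ≤ M * h ^ 2 / 2 := by
  have hpos := sub_linear_interpolant_le hh hM0 hg (fun x hx ↦ (abs_le.1 (hM x hx)).1) hp hq hy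
  have hneg := sub_linear_interpolant_le (g := -g) hh hM0 hg.neg (fun x hx ↦ by
    rw [iteratedDerivWithin_neg]
    exact neg_le_neg (abs_le.1 (hM x hx)).2) hp hq hy
  simp only [Pi.neg_apply] at hneg
  exact abs_le.2 ⟨by linarith, hpos⟩

/-- weighted piecewise-linear interpolation error estimate away from
the singularity: with grid `y_k = a + k h`, `a = c − (n+1)h`, `g ∈ C²([a, c−h])`, and `P = Πg`
the continuous piecewise linear interpolant of `g` on the nodes `y₀,…,y_n`,
`|∫_a^{c−h} (g − Πg)(y) (c−y)^{s−1−β} dy|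
   ≤ (‖g″‖_{L^∞} h²/(2|s−β|)) |h^{s−β} − (c−a)^{s−β}|` for `β ∈ (0,2)`, `s ∈ {0,1}`, `s ≠ β`. -/
theorem piecewise_interpolation_error (β c h : ℝ) (s n : ℕ) (hβ : β ∈ Set.Ioo (0 : ℝ) 2)
    (hs : s = 0 ∨ s = 1) (hsβ : (s : ℝ) ≠ β) (hh : 0 < h) (hn : 1 ≤ n)
    (a : ℝ) (ha : a = c - (n + 1) * h)
    (g P : ℝ → ℝ) (hg : ContDiffOn ℝ 2 g (Set.Icc a (c - h)))
    (hP : ∀ k : ℕ, 1 ≤ k → k ≤ n →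
      ∀ y ∈ Set.Icc (a + ((k : ℝ) - 1) * h) (a + k * h),
        P y = ((y - (a + ((k : ℝ) - 1) * h)) / h) * g (a + k * h)
            + (((a + k * h) - y) / h) * g (a + ((k : ℝ) - 1) * h)) :
    |∫ y in a..(c - h), (g y - P y) * (c - y) ^ ((s : ℝ) - 1 - β)|
      ≤ (⨆ y : Set.Icc a (c - h), |iteratedDerivWithin 2 g (Set.Icc a (c - h)) y|)
          * h ^ 2 / (2 * |(s : ℝ) - β|)
          * |h ^ ((s : ℝ) - β) - (c - a) ^ ((s : ℝ) - β)| := by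
  have hnh : 0 < n * h := mul_pos (by exact_mod_cast hn) hh
  have hend : c - h = a + n * h := by rw [ha]; ring
  set I := Set.Icc a (c - h)
  set M := ⨆ y : I, |iteratedDerivWithin 2 g I y|
  have hac : a < c - h := by linarith
  have hM : ∀ x ∈ I, |iteratedDerivWithin 2 g I x| ≤ M := by
    intro x hx
    have hcont := (hg.continuousOn_iteratedDerivWithin (m := 2) le_rfl (uniqueDiffOn_Icc hac)).abs
    have hbdd := isCompact_Icc.bddAbove_image hcont
    rw [Set.image_eq_range] at hbdd
    exact le_ciSup hbdd (⟨x, hx⟩ : I)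
  have hM0 : 0 ≤ M := Real.iSup_nonneg fun _ ↦ abs_nonneg _
  have herr : ∀ y ∈ Set.Ioc a (c - h), |g y - P y| ≤ M * h ^ 2 / 2 := by
    rintro y ⟨hy1, hy2⟩
    have hpos : 0 < (y - a) / h := div_pos (by linarith) hh
    set k := ⌈(y - a) / h⌉₊
    have hk1 : 1 ≤ k := Nat.ceil_pos.2 hpos
    have hkn : k ≤ n := Nat.ceil_le.2 ((div_le_iff₀ hh).2 (by linarith))
    have hkn' : (k : ℝ) * h ≤ n * h := by gcongr
    have hk1' : (1 : ℝ) ≤ k := by exact_mod_cast hk1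
    have hup : y - a ≤ k * h := (div_le_iff₀ hh).1 (Nat.le_ceil _)
    have hlow : ((k : ℝ) - 1) * h ≤ y - a :=
      (le_div_iff₀ hh).1 (by linarith [Nat.ceil_lt_add_one hpos.le])
    have hq : a + ((k : ℝ) - 1) * h + h = a + k * h := by ring
    have := abs_sub_linear_interpolant_le (p := a + ((k : ℝ) - 1) * h) (y := y) hh hM0 hg hM
      (by nlinarith) (by linarith) ⟨by linarith, by linarith⟩
    rw [hq] at this
    rwa [hP k hk1 hkn y ⟨by linarith, by linarith⟩]
  have hr0 : (s : ℝ) - β ≠ 0 := sub_ne_zero.2 hsβ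
  have h0 : (0 : ℝ) ∉ Set.uIcc h (c - a) := by
    rw [Set.uIcc_of_le (by linarith)]
    exact fun hz ↦ hh.not_ge hz.1
  have hint : ∫ y in a..(c - h), (c - y) ^ ((s : ℝ) - 1 - β)
      = ((c - a) ^ ((s : ℝ) - β) - h ^ ((s : ℝ) - β)) / ((s : ℝ) - β) := by
    rw [intervalIntegral.integral_comp_sub_left (fun x ↦ x ^ ((s : ℝ) - 1 - β)), sub_sub_cancel,
      integral_rpow (Or.inr ⟨fun hc ↦ hr0 (by linarith), h0⟩),
      show (s : ℝ) - 1 - β + 1 = s - β by ring]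
  have hii : IntervalIntegrable (fun y ↦ M * h ^ 2 / 2 * (c - y) ^ ((s : ℝ) - 1 - β))
      volume a (c - h) := by
    refine ContinuousOn.intervalIntegrable (continuousOn_const.mul
      (ContinuousOn.rpow_const (by fun_prop) fun y hy ↦ Or.inl ?_))
    rw [Set.uIcc_of_le hac.le] at hy
    linarith [hy.2]
  have hbound := intervalIntegral.norm_integral_le_of_norm_le
    (f := fun y ↦ (g y - P y) * (c - y) ^ ((s : ℝ) - 1 - β)) hac.le
    (Filter.Eventually.of_forall fun y hy ↦ by
      have hw : 0 ≤ (c - y) ^ ((s : ℝ) - 1 - β) := Real.rpow_nonneg (by linarith [hy.2]) _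
      rw [norm_mul, Real.norm_eq_abs, Real.norm_of_nonneg hw]
      exact mul_le_mul_of_nonneg_right (herr y hy) hw) hii
  rw [Real.norm_eq_abs, intervalIntegral.integral_const_mul, hint] at hbound
  refine hbound.trans ?_
  calc _ ≤ M * h ^ 2 / 2 * |((c - a) ^ ((s : ℝ) - β) - h ^ ((s : ℝ) - β)) / ((s : ℝ) - β)| := by
        gcongr
        exact le_abs_self _
    _ = _ := by
        rw [abs_div, abs_sub_comm]
        field_simp
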